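/- Let G be a free group of finite rank r with free generating set S, acting on a standard Borel probability space (X, μ) by μ-preserving Borel automorphisms, let α be a countable measurable partition of X, and let Σ be a G-invariant sub-σ-algebra. Then for every n ∈ ℕ, with values in [0, ∞]: (1) H(B_{n+1}·α / B_n·α ∨ Σ) ≤ ∑_{s ∈ S ∪ S⁻¹} H(s·B_n·α / B_n·α ∨ Σ), and (2) ∑_{s ∈ S ∪ S⁻¹} H(s·B_{n+1}·α / B_{n+1}·α ∨ Σ) ≤ (2r − 1)·H(B_{n+1}·α / B_n·α ∨ Σ). -/

import Mathlib

open MeasureTheory Filter Set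
open scoped ENNReal symmDiff Pointwise

namespace FPaper

/-- The free group of rank `r`; its free generating set `S` is `{FreeGroup.of i | i : Fin r}`. -/
abbrev FG (r : ℕ) := FreeGroup (Fin r)

/-- The reduced `S`-word length of a group element. -/
def wlen {r : ℕ} (g : FG r) : ℕ := g.toWord.length

/-- The ball of radius `n` in `FG r` with respect to the word length. -/
def ball (r n : ℕ) : Set (FG r) := {g | wlen g ≤ n}

instance ballFinite (r n : ℕ) : Finite (ball r n) := by
  have h : ball r n ⊆ FreeGroup.mk '' {l : List (Fin r × Bool) | l.length ≤ n} :=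
    fun g hg => ⟨g.toWord, hg, FreeGroup.mk_toWord⟩
  exact (((List.finite_length_le _ n).image _).subset h).to_subtype

/-- An action of a group `G` on a measurable space `X` by Borel automorphisms. -/
structure BorelAction (G : Type*) [Group G] (X : Type*) [MeasurableSpace X] where
  act : G → X → X
  act_one : ∀ x, act 1 x = x
  act_mul : ∀ g h x, act (g * h) x = act g (act h x)
  measurable_act : ∀ g, Measurable (act g)

namespace BorelAction

variable {G X : Type*} [Group G] [mX : MeasurableSpace X]

/-- The action preserves the measure `μ`. -/
def Preserves (T : BorelAction G X) (μ : Measure X) : Prop :=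
  ∀ g : G, MeasurePreserving (T.act g) μ μ

/-- The translated set `g · B`. -/
def smulSet (T : BorelAction G X) (g : G) (B : Set X) : Set X := T.act g⁻¹ ⁻¹' B

/-- The translated partition `g · α`, where a countable measurable partition is recorded
by a (measurable, countably-valued) function whose fibers are the cells. -/
def tr {I : Type*} (T : BorelAction G X) (g : G) (a : X → I) : X → I :=
  fun x => a (T.act g⁻¹ x)

/-- The join `F · α = ⋁_{f ∈ F} f · α` of the translates of a partition over a set `F ⊆ G`. -/
def joinF {I : Type*} (T : BorelAction G X) (F : Set G) (a : X → I) : X → (F → I) :=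
  fun x f => a (T.act (f : G)⁻¹ x)

/-- The σ-algebra generated by the partitions `f · α`, `f ∈ F`. -/
def partSA {I : Type*} (T : BorelAction G X) (F : Set G) (a : X → I) : MeasurableSpace X :=
  ⨆ f ∈ F, MeasurableSpace.comap (T.tr f a) ⊤

/-- The partition `a` is generating: the smallest `G`-invariant σ-algebra containing `a`
(i.e. the one generated by all translates of `a`) contains every measurable set up to
`ν`-null sets. -/
def Generating {I : Type*} (T : BorelAction G X) (a : X → I) (ν : Measure X) : Prop :=
  ∀ B : Set X, MeasurableSet B →
    ∃ B', MeasurableSet[T.partSA Set.univ a] B' ∧ ν (B ∆ B') = 0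


/-- Ergodicity of the action with respect to `ν`. -/
def IsErgodic (T : BorelAction G X) (ν : Measure X) : Prop :=
  ∀ B : Set X, MeasurableSet B → (∀ g : G, ν (T.smulSet g B ∆ B) = 0) → ν B = 0 ∨ ν B = 1

/-- The action is essentially free with respect to `ν`. -/
def EssentiallyFree (T : BorelAction G X) (ν : Measure X) : Prop :=
  ν {x | ∀ g : G, g ≠ 1 → T.act g x ≠ x} = 1

/-- The stabilizer subgroup of a point. -/
def stab (T : BorelAction G X) (y : X) : Subgroup G where
  carrier := {g | T.act g y = y}
  one_mem' := T.act_one y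
  mul_mem' := by
    intro g h hg hh
    simp only [Set.mem_setOf_eq] at *
    rw [T.act_mul, hh, hg]
  inv_mem' := by
    intro g hg
    simp only [Set.mem_setOf_eq] at *
    conv_lhs => rw [← hg]
    rw [← T.act_mul, inv_mul_cancel, T.act_one]

end BorelAction

/-- `m` is a `G`-invariant sub-σ-algebra. -/
def InvariantSA {G X : Type*} [Group G] (m : MeasurableSpace X) [mX : MeasurableSpace X]
    (T : BorelAction G X) : Prop :=
  m ≤ mX ∧ ∀ (g : G) (B : Set X), MeasurableSet[m] B → MeasurableSet[m] (T.act g ⁻¹' B)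

/-- A measure is purely atomic: the set of atoms has full measure. -/
def PurelyAtomic {X : Type*} [MeasurableSpace X] (ν : Measure X) : Prop :=
  ν {x | 0 < ν {x}} = 1

/-- Shannon entropy of a countable measurable partition (recorded as a countably-valued
function), with values in `[0, ∞]`. -/
noncomputable def Hpart {X I : Type*} [MeasurableSpace X] [Countable I]
    (μ : Measure X) (a : X → I) : ℝ≥0∞ :=
  ∑' i : I, ENNReal.ofReal (Real.negMulLog (μ (a ⁻¹' {i})).toReal)

/-- Conditional Shannon entropy of a countable partition given a sub-σ-algebra `m`:
`H(α/m) = ∫ ∑_{A ∈ α} φ(E[1_A | m](x)) dμ(x)` with `φ(t) = -t log t`. -/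
noncomputable def condEntS {X I : Type*} (m : MeasurableSpace X) [mX : MeasurableSpace X]
    [Countable I] (μ : Measure X) (a : X → I) : ℝ≥0∞ :=
  ∫⁻ x, ∑' i : I,
    ENNReal.ofReal (Real.negMulLog ((μ[(a ⁻¹' {i}).indicator (fun _ => (1:ℝ)) | m]) x)) ∂μ

/-- Conditional Shannon entropy of a partition given another partition:
`H(α/β) = ∑_{B ∈ β} ∑_{A ∈ α} -μ(B) · (μ(A∩B)/μ(B)) · log (μ(A∩B)/μ(B))`
(equivalently `H(α ∨ β) − H(β)`), with values in `[0, ∞]`. -/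
noncomputable def condEntP {X I J : Type*} [MeasurableSpace X] [Countable I] [Countable J]
    (μ : Measure X) (a : X → I) (b : X → J) : ℝ≥0∞ :=
  ∑' q : I × J, μ (b ⁻¹' {q.2}) *
    ENNReal.ofReal (Real.negMulLog
      ((μ (a ⁻¹' {q.1} ∩ b ⁻¹' {q.2})).toReal / (μ (b ⁻¹' {q.2})).toReal))

/-- `F_G(X, μ, S, β) = (1-2r)·H(β) + ∑_{s ∈ S} H(s·β ∨ β)`. -/
noncomputable def FF {r : ℕ} {X I : Type*} [MeasurableSpace X] [Countable I]
    (μ : Measure X) (T : BorelAction (FG r) X) (b : X → I) : ℝ :=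
  (1 - 2 * (r : ℝ)) * (Hpart μ b).toReal
    + ∑ i : Fin r, (Hpart μ (fun x => (T.tr (FreeGroup.of i) b x, b x))).toReal

/-- The sequence `n ↦ F_G(X, μ, S, B_n · α)`. -/
noncomputable def fSeq {r : ℕ} {X : Type*} [MeasurableSpace X]
    (μ : Measure X) (T : BorelAction (FG r) X) (a : X → ℕ) (n : ℕ) : ℝ :=
  FF μ T (T.joinF (ball r n) a)

/-- The f-invariant entropy `f_G(X, μ) = lim_n F_G(X, μ, S, B_n·α)`, the limit (= infimum,
since the sequence is non-increasing) of the sequence `fSeq`, with values in `[-∞, ∞)`. -/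
noncomputable def fInv {r : ℕ} {X : Type*} [MeasurableSpace X]
    (μ : Measure X) (T : BorelAction (FG r) X) (a : X → ℕ) : EReal :=
  ⨅ n : ℕ, ((fSeq μ T a n : ℝ) : EReal)

/-- Relative version `F_G(X, μ/Σ, S, β) = (1-2r)·H(β/Σ) + ∑_{s ∈ S} H(s·β ∨ β / Σ)`. -/
noncomputable def FFrel {r : ℕ} {X I : Type*} (m : MeasurableSpace X) [mX : MeasurableSpace X]
    [Countable I] (μ : Measure X) (T : BorelAction (FG r) X) (b : X → I) : ℝ :=
  (1 - 2 * (r : ℝ)) * (condEntS m μ b).toReal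
    + ∑ i : Fin r, (condEntS m μ (fun x => (T.tr (FreeGroup.of i) b x, b x))).toReal

/-- The sequence `n ↦ F_G(X, μ/Σ, S, B_n · α)`. -/
noncomputable def fSeqRel {r : ℕ} {X : Type*} (m : MeasurableSpace X) [mX : MeasurableSpace X]
    (μ : Measure X) (T : BorelAction (FG r) X) (a : X → ℕ) (n : ℕ) : ℝ :=
  FFrel m μ T (T.joinF (ball r n) a)

/-- The relative f-invariant entropy `f_G(X, μ/Σ)`, with values in `[-∞, ∞)`. -/
noncomputable def fInvRel {r : ℕ} {X : Type*} (m : MeasurableSpace X) [mX : MeasurableSpace X]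
    (μ : Measure X) (T : BorelAction (FG r) X) (a : X → ℕ) : EReal :=
  ⨅ n : ℕ, ((fSeqRel m μ T a n : ℝ) : EReal)

/-- A total order on `S ∪ S⁻¹` is recorded by an injection `ord : Fin r × Bool → ℕ`;
`g ≺ h` iff `|g| < |h|`, or `|g| = |h|` and the reduced word of `g` lexicographically
precedes that of `h`. -/
def wlt {r : ℕ} (ord : Fin r × Bool → ℕ) (g h : FG r) : Prop :=
  wlen g < wlen h ∨ (wlen g = wlen h ∧ List.Lex (fun p q => ord p < ord q) g.toWord h.toWord)

/-- `Pre(g)`: the set of elements strictly preceding `g`. -/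
def Pre {r : ℕ} (ord : Fin r × Bool → ℕ) (g : FG r) : Set (FG r) := {h | wlt ord h g}

/-- The generator or inverse generator corresponding to a letter. -/
def letter {r : ℕ} (p : Fin r × Bool) : FG r :=
  if p.2 then FreeGroup.of p.1 else (FreeGroup.of p.1)⁻¹

/-- The first (leftmost) letter of the reduced word of `g` (junk value `1` for `g = 1`). -/
def firstLetter {r : ℕ} (g : FG r) : FG r := ((g.toWord.head?).map letter).getD 1

/-- The independence decay `δ(g, α/Σ)`, as a real number:
`δ(g, α/Σ) = H(s⁻¹g·α / Pre(s⁻¹g)·α ∨ Σ) − H(g·α / Pre(g)·α ∨ Σ)` where `s` is the first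
letter of `g`. -/
noncomputable def idecay {r : ℕ} {X I : Type*} (m : MeasurableSpace X) [mX : MeasurableSpace X]
    [Countable I] (μ : Measure X) (T : BorelAction (FG r) X)
    (ord : Fin r × Bool → ℕ) (a : X → I) (g : FG r) : ℝ :=
  (condEntS (m ⊔ T.partSA (Pre ord ((firstLetter g)⁻¹ * g)) a) μ
      (T.tr ((firstLetter g)⁻¹ * g) a)).toReal
  - (condEntS (m ⊔ T.partSA (Pre ord g) a) μ (T.tr g a)).toReal

/-- The entropy `H(τ)` of a probability space: the supremum of the Shannon entropies of
finite measurable partitions. -/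
noncomputable def measEnt {M : Type*} [MeasurableSpace M] (τ : Measure M) : ℝ≥0∞ :=
  ⨆ (P : Finset (Set M)) (_ : ∀ p ∈ P, MeasurableSet p)
    (_ : (P : Set (Set M)).PairwiseDisjoint id) (_ : ⋃₀ (P : Set (Set M)) = Set.univ),
    ∑ p ∈ P, ENNReal.ofReal (Real.negMulLog (τ p).toReal)

/-- The non-negative part of an extended real, in `ℝ≥0∞`. -/
noncomputable def erealToENNReal (x : EReal) : ℝ≥0∞ :=
  if x = ⊤ then ⊤ else ENNReal.ofReal x.toReal

/-- The integral of an `EReal`-valued function (positive part minus negative part),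
with values in `[-∞, ∞]`. -/
noncomputable def eIntegral {M : Type*} [MeasurableSpace M] (τ : Measure M) (f : M → EReal) :
    EReal :=
  ((∫⁻ m, erealToENNReal (f m) ∂τ : ℝ≥0∞) : EReal)
    - ((∫⁻ m, erealToENNReal (-(f m)) ∂τ : ℝ≥0∞) : EReal)

/-- The set of `G`-invariant Borel probability measures on `X`. -/
def InvProb {G X : Type*} [Group G] [MeasurableSpace X] (T : BorelAction G X) :
    Set (Measure X) :=
  {ν | IsProbabilityMeasure ν ∧ ∀ g : G, MeasurePreserving (T.act g) ν ν}

section EntropyCalculus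

/-- The function `t ↦ -log t` on `[0, 1]`, with values in `[0, ∞]`. -/
noncomputable def nlog (t : ℝ≥0∞) : ℝ≥0∞ :=
  if t = 0 then ⊤ else ENNReal.ofReal (-Real.log t.toReal)

theorem nlog_one : nlog 1 = 0 := by simp [nlog]

theorem measurable_nlog : Measurable nlog :=
  Measurable.ite (measurableSet_singleton 0) measurable_const (by fun_prop)

theorem nlog_mul {s t : ℝ≥0∞} (hs : s ≤ 1) (ht : t ≤ 1) : nlog (s * t) = nlog s + nlog t := by
  rcases eq_or_ne s 0 with rfl | hs0
  · simp [nlog]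
  rcases eq_or_ne t 0 with rfl | ht0
  · simp [nlog]
  have hs1 := ENNReal.toReal_pos hs0 (ne_top_of_le_ne_top ENNReal.one_ne_top hs)
  have ht1 := ENNReal.toReal_pos ht0 (ne_top_of_le_ne_top ENNReal.one_ne_top ht)
  have hs2 : s.toReal ≤ 1 := ENNReal.toReal_le_of_le_ofReal zero_le_one (by simpa using hs)
  have ht2 : t.toReal ≤ 1 := ENNReal.toReal_le_of_le_ofReal zero_le_one (by simpa using ht)
  rw [nlog, nlog, nlog, if_neg (mul_ne_zero hs0 ht0), if_neg hs0, if_neg ht0,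
    ENNReal.toReal_mul, Real.log_mul hs1.ne' ht1.ne', neg_add, ENNReal.ofReal_add]
  · exact neg_nonneg.2 (Real.log_nonpos hs1.le hs2)
  · exact neg_nonneg.2 (Real.log_nonpos ht1.le ht2)

theorem ofReal_negMulLog_toReal (t : ℝ≥0∞) (ht : t ≤ 1) :
    ENNReal.ofReal (Real.negMulLog t.toReal) = t * nlog t := by
  rcases eq_or_ne t 0 with rfl | ht0
  · simp
  have ht' : t ≠ ⊤ := ne_top_of_le_ne_top ENNReal.one_ne_top ht
  rw [nlog, if_neg ht0, Real.negMulLog, neg_mul, ← mul_neg,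
    ENNReal.ofReal_mul ENNReal.toReal_nonneg, ENNReal.ofReal_toReal ht']

/-- The graph of `t ↦ -t log t` lies below its tangent at `q`. -/
theorem mul_nlog_add_le {p q : ℝ≥0∞} (hp : p ≤ 1) (hq : q ≤ 1) :
    p * nlog p + p ≤ p * nlog q + q := by
  rcases eq_or_ne p 0 with rfl | hp0
  · simp
  rcases eq_or_ne q 0 with rfl | hq0
  · simp [nlog, hp0]
  have hpt : p ≠ ⊤ := ne_top_of_le_ne_top ENNReal.one_ne_top hp
  have hqt : q ≠ ⊤ := ne_top_of_le_ne_top ENNReal.one_ne_top hq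
  have hp1 := ENNReal.toReal_pos hp0 hpt
  have hq1 := ENNReal.toReal_pos hq0 hqt
  have hp2 : p.toReal ≤ 1 := ENNReal.toReal_le_of_le_ofReal zero_le_one (by simpa using hp)
  have hq2 : q.toReal ≤ 1 := ENNReal.toReal_le_of_le_ofReal zero_le_one (by simpa using hq)
  have hpl := neg_nonneg.2 (Real.log_nonpos hp1.le hp2)
  have hql := neg_nonneg.2 (Real.log_nonpos hq1.le hq2)
  rw [nlog, nlog, if_neg hp0, if_neg hq0, ← ENNReal.ofReal_toReal hpt,
    ← ENNReal.ofReal_toReal hqt, ENNReal.toReal_ofReal hp1.le, ENNReal.toReal_ofReal hq1.le,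
    ← ENNReal.ofReal_mul hp1.le, ← ENNReal.ofReal_mul hp1.le,
    ← ENNReal.ofReal_add (by positivity) hp1.le, ← ENNReal.ofReal_add (by positivity) hq1.le]
  refine ENNReal.ofReal_le_ofReal ?_
  have h := mul_le_mul_of_nonneg_left (Real.log_le_sub_one_of_pos (div_pos hq1 hp1)) hp1.le
  rw [Real.log_div hq1.ne' hp1.ne', mul_sub, mul_sub, mul_div_cancel₀ _ hp1.ne'] at h
  linarith

variable {X I J : Type*}

/-- The conditional probability of `A` given `m`, with values in `[0, ∞]`. -/
noncomputable abbrev cprob (m : MeasurableSpace X) [mX : MeasurableSpace X] (μ : Measure X)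
    (A : Set X) : X → ℝ≥0∞ :=
  μ⁻[A.indicator (fun _ => (1 : ℝ≥0∞)) | m]

theorem measurable_nlog_cprob (m : MeasurableSpace X) [mX : MeasurableSpace X] (μ : Measure X)
    (A : Set X) : Measurable[m] fun x => nlog (cprob m μ A x) :=
  measurable_nlog.comp (measurable_condLExp m μ _)

theorem cprob_le_one (m : MeasurableSpace X) [mX : MeasurableSpace X] (hm : m ≤ mX)
    (μ : Measure X) [IsProbabilityMeasure μ] (A : Set X) :
    ∀ᵐ x ∂μ, cprob m μ A x ≤ 1 := by
  have h : cprob m μ A ≤ᵐ[μ] μ⁻[fun _ => (1 : ℝ≥0∞) | m] :=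
    condLExp_mono (ae_of_all _ fun x => Set.indicator_le_self' (by simp) x)
  rw [condLExp_const hm] at h
  exact h

theorem toReal_cprob (m : MeasurableSpace X) [mX : MeasurableSpace X]
    (μ : Measure X) [IsProbabilityMeasure μ] {A : Set X} (hA : MeasurableSet A) :
    ∀ᵐ x ∂μ, (μ[A.indicator (fun _ => (1 : ℝ)) | m]) x = (cprob m μ A x).toReal := by
  have h := toReal_condLExp m (μ := μ) (f := A.indicator (fun _ => (1 : ℝ≥0∞)))
    ((measurable_const.indicator hA).aemeasurable)
    (by simp [lintegral_indicator hA])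
  have h2 : (fun x => (A.indicator (fun _ => (1 : ℝ≥0∞)) x).toReal)
      = A.indicator (fun _ => (1 : ℝ)) := by
    ext x; by_cases hx : x ∈ A <;> simp [hx]
  rw [h2] at h
  filter_upwards [h] with x hx using hx.symm

/-- Integrals of `m`-measurable functions over `A` are weighted by the conditional probability
of `A` given `m`. -/
theorem setLIntegral_eq_lintegral_cprob_mul (m : MeasurableSpace X) [mX : MeasurableSpace X]
    (hm : m ≤ mX) (μ : Measure X) [IsProbabilityMeasure μ] {A : Set X} (hA : MeasurableSet A)
    {g : X → ℝ≥0∞} (hg : Measurable[m] g) :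
    ∫⁻ x in A, g x ∂μ = ∫⁻ x, cprob m μ A x * g x ∂μ := by
  have hmeas : (μ.restrict A).trim hm = (μ.withDensity (cprob m μ A)).trim hm := by
    refine @Measure.ext _ m _ _ fun s hs => ?_
    rw [trim_measurableSet_eq hm hs, trim_measurableSet_eq hm hs, Measure.restrict_apply (hm s hs),
      withDensity_apply _ (hm s hs), setLIntegral_condLExp hm μ _ hs,
      setLIntegral_indicator hA]
    simp [Set.inter_comm]
  rw [← lintegral_trim hm hg, hmeas, lintegral_trim hm hg,
    lintegral_withDensity_eq_lintegral_mul _ (measurable_condLExp' m μ _) (hg.mono hm le_rfl)]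
  rfl

theorem condEntS_eq_tsum (m : MeasurableSpace X) [mX : MeasurableSpace X] (hm : m ≤ mX)
    (μ : Measure X) [IsProbabilityMeasure μ] [Countable I] {a : X → I}
    (ha : ∀ i, MeasurableSet (a ⁻¹' {i})) :
    condEntS m μ a = ∑' i, ∫⁻ x in a ⁻¹' {i}, nlog (cprob m μ (a ⁻¹' {i}) x) ∂μ := by
  have h1 : condEntS m μ a = ∫⁻ x, ∑' i, cprob m μ (a ⁻¹' {i}) x
      * nlog (cprob m μ (a ⁻¹' {i}) x) ∂μ := by
    refine lintegral_congr_ae ?_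
    filter_upwards [ae_all_iff.2 fun i => toReal_cprob m μ (ha i),
      ae_all_iff.2 fun i => cprob_le_one m hm μ (a ⁻¹' {i})] with x hx hx1
    exact tsum_congr fun i => by rw [hx i, ofReal_negMulLog_toReal _ (hx1 i)]
  rw [h1, lintegral_tsum]
  · exact tsum_congr fun i => (setLIntegral_eq_lintegral_cprob_mul m hm μ (ha i)
      (measurable_nlog_cprob m μ _)).symm
  · exact fun i => ((measurable_condLExp' m μ _).mul
      ((measurable_nlog_cprob m μ _).mono hm le_rfl)).aemeasurable

theorem condEntS_eq_zero (m : MeasurableSpace X) [mX : MeasurableSpace X] (hm : m ≤ mX)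
    (μ : Measure X) [IsProbabilityMeasure μ] [Countable I] {a : X → I}
    (ha : ∀ i, MeasurableSet[m] (a ⁻¹' {i})) : condEntS m μ a = 0 := by
  rw [condEntS_eq_tsum m hm μ fun i => hm _ (ha i), ENNReal.tsum_eq_zero]
  intro i
  rw [cprob, condLExp_eq_self hm μ (measurable_const.indicator (ha i))]
  rw [setLIntegral_congr_fun (hm _ (ha i)) (g := fun _ => 0) fun x hx => by
    simp only [Set.indicator_of_mem hx, nlog_one]]
  simp

theorem condEntS_anti (m m' : MeasurableSpace X) [mX : MeasurableSpace X] (hmm : m ≤ m')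
    (hm' : m' ≤ mX) (μ : Measure X) [IsProbabilityMeasure μ] [Countable I] {a : X → I}
    (ha : ∀ i, MeasurableSet (a ⁻¹' {i})) : condEntS m' μ a ≤ condEntS m μ a := by
  have hm := hmm.trans hm'
  rw [condEntS_eq_tsum m hm μ ha, condEntS_eq_tsum m' hm' μ ha]
  refine ENNReal.tsum_le_tsum fun i => ?_
  set A := a ⁻¹' {i}
  have hA : MeasurableSet A := ha i
  rw [setLIntegral_eq_lintegral_cprob_mul m' hm' μ hA
      (measurable_nlog_cprob m' μ A),
    setLIntegral_eq_lintegral_cprob_mul m' hm' μ hA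
      ((measurable_nlog_cprob m μ A).mono hmm le_rfl)]
  have hfin : ∫⁻ x, cprob m' μ A x ∂μ ≠ ⊤ := by
    rw [lintegral_condLExp hm', lintegral_indicator hA]
    simp
  refine ENNReal.le_of_add_le_add_right hfin ?_
  have hpq : ∫⁻ x, cprob m' μ A x ∂μ = ∫⁻ x, cprob m μ A x ∂μ := by
    rw [lintegral_condLExp hm', lintegral_condLExp hm]
  nth_rw 2 [hpq]
  rw [← lintegral_add_right _ (measurable_condLExp' m' μ _),
    ← lintegral_add_right _ (measurable_condLExp' m μ _)]
  refine lintegral_mono_ae ?_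
  filter_upwards [cprob_le_one m hm μ A, cprob_le_one m' hm' μ A] with x h1 h2
  exact mul_nlog_add_le h2 h1

theorem condEntS_equiv_comp (m : MeasurableSpace X) [mX : MeasurableSpace X]
    (μ : Measure X) [Countable I] [Countable J] (e : I ≃ J) (a : X → I) :
    condEntS m μ (fun x => e (a x)) = condEntS m μ a := by
  refine lintegral_congr fun x => ?_
  rw [← e.tsum_eq]
  refine tsum_congr fun i => ?_
  have : (fun x => e (a x)) ⁻¹' {e i} = a ⁻¹' {i} := by ext; simp
  rw [this]

theorem comap_top_le_of_fibers (m : MeasurableSpace X) [Countable I] {a : X → I}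
    (ha : ∀ i, MeasurableSet[m] (a ⁻¹' {i})) : MeasurableSpace.comap a ⊤ ≤ m := by
  rintro _ ⟨s, -, rfl⟩
  rw [← Set.biUnion_preimage_singleton]
  exact MeasurableSet.biUnion s.to_countable fun i _ => ha i

/-- On a fiber of `b`, the σ-algebra `m ⊔ σ(b)` has the same trace as `m`. -/
theorem exists_measurableSet_inter_fiber_eq (m : MeasurableSpace X) (b : X → J) (j : J)
    {C : Set X} (hC : MeasurableSet[m ⊔ MeasurableSpace.comap b ⊤] C) :
    ∃ s, MeasurableSet[m] s ∧ C ∩ b ⁻¹' {j} = s ∩ b ⁻¹' {j} := by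
  let v : b ⁻¹' {j} → X := Subtype.val
  have hle : (m ⊔ MeasurableSpace.comap b ⊤).comap v ≤ m.comap v := by
    rw [MeasurableSpace.comap_sup, MeasurableSpace.comap_comp]
    refine sup_le le_rfl ?_
    have : b ∘ v = fun _ => j := funext fun x => x.2
    rw [this, MeasurableSpace.comap_const]
    exact bot_le
  obtain ⟨s, hs, h⟩ := hle _ ⟨C, hC, rfl⟩
  have hCs := (Subtype.preimage_val_eq_preimage_val_iff _ _ _).1 h.symm
  exact ⟨s, hs, by rw [Set.inter_comm, hCs, Set.inter_comm]⟩

theorem cprob_inter_fiber (m m' : MeasurableSpace X) [mX : MeasurableSpace X] (hm : m ≤ mX)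
    (μ : Measure X) [IsProbabilityMeasure μ] [Countable J] {b : X → J}
    (hb : ∀ j, MeasurableSet (b ⁻¹' {j})) (hmb : m' = m ⊔ MeasurableSpace.comap b ⊤)
    (j : J) {A : Set X} (hA : MeasurableSet A) :
    ∀ᵐ x ∂μ, x ∈ b ⁻¹' {j} → cprob m μ (A ∩ b ⁻¹' {j}) x
      = cprob m μ (b ⁻¹' {j}) x * cprob m' μ A x := by
  set B := b ⁻¹' {j} with hBdef
  have hB : MeasurableSet B := hb j
  have hm' : m' ≤ mX := hmb ▸ sup_le hm (comap_top_le_of_fibers mX hb)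
  have hmm : m ≤ m' := hmb ▸ le_sup_left
  have hB' : MeasurableSet[m'] B :=
    (hmb ▸ le_sup_right : MeasurableSpace.comap b ⊤ ≤ m') _ ⟨{j}, trivial, rfl⟩
  have hAB : Measurable[m'] (cprob m μ (A ∩ B)) :=
    (measurable_condLExp m μ _).mono hmm le_rfl
  have hBm : Measurable[m'] (cprob m μ B) :=
    (measurable_condLExp m μ _).mono hmm le_rfl
  have hu : Measurable[m'] (B.indicator (cprob m μ (A ∩ B))) := hAB.indicator hB'
  have hv : Measurable[m'] (B.indicator (cprob m μ B * cprob m' μ A)) :=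
    (hBm.mul (measurable_condLExp m' μ _)).indicator hB'
  have key : B.indicator (cprob m μ (A ∩ B)) =ᵐ[μ] B.indicator (cprob m μ B * cprob m' μ A) := by
    refine ae_eq_of_ae_eq_trim (hm := hm') ?_
    refine ae_eq_of_forall_setLIntegral_eq_of_sigmaFinite hu hv fun C hC _ => ?_
    rw [setLIntegral_trim hm' hu hC, setLIntegral_trim hm' hv hC, setLIntegral_indicator hB,
      setLIntegral_indicator hB, Set.inter_comm]
    obtain ⟨s, hs, hsC⟩ := exists_measurableSet_inter_fiber_eq m b j (hmb ▸ hC)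
    rw [← hBdef] at hsC
    have hsX := hm s hs
    have hg1 : Measurable[m] (s.indicator (cprob m μ (A ∩ B))) :=
      (measurable_condLExp m μ _).indicator hs
    have hg2 : Measurable[m] (s.indicator (cprob m μ B)) :=
      (measurable_condLExp m μ _).indicator hs
    have hg3 : Measurable[m'] ((s ∩ B).indicator (cprob m μ B)) :=
      hBm.indicator ((hmm s hs).inter hB')
    rw [hsC]
    have e1 : ∫⁻ x in s ∩ B, cprob m μ (A ∩ B) x ∂μ
        = ∫⁻ x, cprob m μ B x * s.indicator (cprob m μ (A ∩ B)) x ∂μ := by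
      rw [← setLIntegral_eq_lintegral_cprob_mul m hm μ hB hg1, setLIntegral_indicator hsX]
    have e2 : ∫⁻ x in s ∩ B, (cprob m μ B * cprob m' μ A) x ∂μ
        = ∫⁻ x, cprob m μ (A ∩ B) x * s.indicator (cprob m μ B) x ∂μ := by
      rw [← setLIntegral_eq_lintegral_cprob_mul m hm μ (hA.inter hB) hg2,
        setLIntegral_indicator hsX]
      calc _ = ∫⁻ x, cprob m' μ A x * (s ∩ B).indicator (cprob m μ B) x ∂μ := by
            rw [← lintegral_indicator (hsX.inter hB)]
            refine lintegral_congr fun x => ?_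
            by_cases hx : x ∈ s ∩ B <;> simp [hx, mul_comm]
        _ = _ := by
            rw [← setLIntegral_eq_lintegral_cprob_mul m' hm' μ hA hg3,
              setLIntegral_indicator (hsX.inter hB)]
            congr 2
            ext x; simp only [Set.mem_inter_iff]; tauto
    rw [e1, e2]
    refine lintegral_congr fun x => ?_
    by_cases hx : x ∈ s <;> simp [hx, mul_comm]
  filter_upwards [key] with x hx hxB
  simpa [hxB] using hx

theorem setLIntegral_eq_tsum_fiber [MeasurableSpace X] (μ : Measure X) [Countable J] {b : X → J}
    (hb : ∀ j, MeasurableSet (b ⁻¹' {j})) {A : Set X} (hA : MeasurableSet A) (f : X → ℝ≥0∞) :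
    ∫⁻ x in A, f x ∂μ = ∑' j, ∫⁻ x in A ∩ b ⁻¹' {j}, f x ∂μ := by
  rw [← lintegral_iUnion (fun j => hA.inter (hb j))]
  · rw [← Set.inter_iUnion, ← Set.preimage_iUnion, Set.iUnion_of_singleton, Set.preimage_univ,
      Set.inter_univ]
  · intro j j' hj
    exact Set.disjoint_left.2 fun x hx hx' => hj (hx.2.symm.trans hx'.2)

/-- The chain rule for conditional entropy. -/
theorem condEntS_prod (m : MeasurableSpace X) [mX : MeasurableSpace X] (hm : m ≤ mX)
    (μ : Measure X) [IsProbabilityMeasure μ] [Countable I] [Countable J] {a : X → I} {b : X → J}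
    (ha : ∀ i, MeasurableSet (a ⁻¹' {i})) (hb : ∀ j, MeasurableSet (b ⁻¹' {j})) :
    condEntS m μ (fun x => (a x, b x))
      = condEntS m μ b + condEntS (m ⊔ MeasurableSpace.comap b ⊤) μ a := by
  have hm' : m ⊔ MeasurableSpace.comap b ⊤ ≤ mX :=
    sup_le hm (comap_top_le_of_fibers mX hb)
  have hfib : ∀ q : I × J, (fun x => (a x, b x)) ⁻¹' {q} = a ⁻¹' {q.1} ∩ b ⁻¹' {q.2} := by
    intro q; ext x; simp [Prod.ext_iff]
  rw [condEntS_eq_tsum m hm μ fun q => hfib q ▸ (ha q.1).inter (hb q.2),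
    condEntS_eq_tsum m hm μ hb, condEntS_eq_tsum _ hm' μ ha]
  have hterm : ∀ q : I × J,
      ∫⁻ x in (fun x => (a x, b x)) ⁻¹' {q}, nlog (cprob m μ ((fun x => (a x, b x)) ⁻¹' {q}) x) ∂μ
        = ∫⁻ x in b ⁻¹' {q.2} ∩ a ⁻¹' {q.1}, nlog (cprob m μ (b ⁻¹' {q.2}) x) ∂μ
          + ∫⁻ x in a ⁻¹' {q.1} ∩ b ⁻¹' {q.2},
              nlog (cprob (m ⊔ MeasurableSpace.comap b ⊤) μ (a ⁻¹' {q.1}) x) ∂μ := by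
    intro q
    rw [hfib, Set.inter_comm (b ⁻¹' {q.2}),
      ← lintegral_add_left ((measurable_nlog_cprob m μ _).mono hm le_rfl)]
    refine setLIntegral_congr_fun_ae ((ha q.1).inter (hb q.2)) ?_
    filter_upwards [cprob_inter_fiber m _ hm μ hb rfl q.2 (ha q.1), cprob_le_one m hm μ _,
      cprob_le_one _ hm' μ _] with x hx h1 h2 hxq
    rw [hx hxq.2, nlog_mul h1 h2]
  rw [tsum_congr hterm, ENNReal.tsum_add]
  congr 1
  · rw [ENNReal.tsum_prod', ENNReal.tsum_comm]
    exact tsum_congr fun j => (setLIntegral_eq_tsum_fiber μ ha (hb j)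
      fun x => nlog (cprob m μ (b ⁻¹' {j}) x)).symm
  · rw [ENNReal.tsum_prod']
    exact tsum_congr fun i => (setLIntegral_eq_tsum_fiber μ hb (ha i)
      fun x => nlog (cprob (m ⊔ MeasurableSpace.comap b ⊤) μ (a ⁻¹' {i}) x)).symm

/-- Invariance of conditional entropy under a measure preserving transformation. -/
theorem condEntS_comap (m : MeasurableSpace X) [mX : MeasurableSpace X] (hm : m ≤ mX)
    (μ : Measure X) [IsProbabilityMeasure μ] [Countable I] {a : X → I}
    (ha : ∀ i, MeasurableSet (a ⁻¹' {i})) {T : X → X} (hT : MeasurePreserving T μ μ) :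
    condEntS (m.comap T) μ (fun x => a (T x)) = condEntS m μ a := by
  have hmT : m.comap T ≤ mX :=
    (MeasurableSpace.comap_mono hm).trans hT.measurable.comap_le
  have hpre : ∀ i, (fun x => a (T x)) ⁻¹' {i} = T ⁻¹' (a ⁻¹' {i}) := fun _ => rfl
  rw [condEntS_eq_tsum (a := fun x => a (T x)) _ hmT μ fun i => hT.measurable (ha i), condEntS_eq_tsum m hm μ ha]
  refine tsum_congr fun i => ?_
  rw [hpre]
  set A := a ⁻¹' {i}
  have hA : MeasurableSet A := ha i
  have hcp : (fun x => cprob m μ A (T x)) =ᵐ[μ] cprob (m.comap T) μ (T ⁻¹' A) := by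
    refine ae_eq_condLExp hmT μ _
      ((measurable_condLExp m μ _).comp (comap_measurable T)) ?_
    rintro _ ⟨s, hs, rfl⟩
    rw [hT.setLIntegral_comp_preimage (hm s hs) (measurable_condLExp' m μ _),
      setLIntegral_condLExp hm μ _ hs, setLIntegral_indicator hA,
      setLIntegral_indicator (hT.measurable hA), ← Set.preimage_inter,
      setLIntegral_one, setLIntegral_one,
      hT.measure_preimage (hA.inter (hm s hs)).nullMeasurableSet]
  rw [← hT.setLIntegral_comp_preimage hA ((measurable_nlog_cprob m μ A).mono hm le_rfl)]
  refine lintegral_congr_ae (ae_restrict_of_ae ?_)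
  filter_upwards [hcp] with x hx
  simp only [hx]

theorem condEntS_le_of_measurable (m : MeasurableSpace X) [mX : MeasurableSpace X] (hm : m ≤ mX)
    (μ : Measure X) [IsProbabilityMeasure μ] [Countable I] [Countable J] {a : X → I} {b : X → J}
    (hb : ∀ j, MeasurableSet (b ⁻¹' {j}))
    (hab : ∀ i, MeasurableSet[m ⊔ MeasurableSpace.comap b ⊤] (a ⁻¹' {i})) :
    condEntS m μ a ≤ condEntS m μ b := by
  have hm' : m ⊔ MeasurableSpace.comap b ⊤ ≤ mX :=
    sup_le hm (comap_top_le_of_fibers mX hb)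
  have ha : ∀ i, MeasurableSet (a ⁻¹' {i}) := fun i => hm' _ (hab i)
  have h := condEntS_prod m hm μ ha hb
  rw [condEntS_eq_zero _ hm' μ hab, add_zero, ← condEntS_equiv_comp m μ (Equiv.prodComm I J)] at h
  rw [← h]
  exact le_self_add.trans (condEntS_prod m hm μ hb ha).ge

theorem condEntS_eq_of_comap_eq (m : MeasurableSpace X) [mX : MeasurableSpace X] (hm : m ≤ mX)
    (μ : Measure X) [IsProbabilityMeasure μ] [Countable I] [Countable J] {a : X → I} {b : X → J}
    (hb : ∀ j, MeasurableSet (b ⁻¹' {j}))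
    (hab : MeasurableSpace.comap a ⊤ = MeasurableSpace.comap b ⊤) :
    condEntS m μ a = condEntS m μ b := by
  have ha : ∀ i, MeasurableSet (a ⁻¹' {i}) := fun i =>
    comap_top_le_of_fibers mX hb _ (hab ▸ ⟨{i}, trivial, rfl⟩)
  exact le_antisymm
    (condEntS_le_of_measurable m hm μ hb fun i =>
      (hab ▸ le_sup_right : MeasurableSpace.comap a ⊤ ≤ m ⊔ MeasurableSpace.comap b ⊤) _
        ⟨{i}, trivial, rfl⟩)
    (condEntS_le_of_measurable m hm μ ha fun j =>
      (hab ▸ le_sup_right : MeasurableSpace.comap b ⊤ ≤ m ⊔ MeasurableSpace.comap a ⊤) _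
        ⟨{j}, trivial, rfl⟩)

theorem comap_prodMk_top [Countable I] [Countable J] (a : X → I) (b : X → J) :
    MeasurableSpace.comap (fun x => (a x, b x)) ⊤
      = MeasurableSpace.comap a ⊤ ⊔ MeasurableSpace.comap b ⊤ := by
  refine le_antisymm (comap_top_le_of_fibers _ fun q => ?_) (sup_le ?_ ?_)
  · have : (fun x => (a x, b x)) ⁻¹' {q} = a ⁻¹' {q.1} ∩ b ⁻¹' {q.2} := by
      ext x; simp [Prod.ext_iff]
    rw [this]
    exact MeasurableSet.inter
      ((le_sup_left : MeasurableSpace.comap a ⊤ ≤ _) _ ⟨{q.1}, trivial, rfl⟩)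
      ((le_sup_right : MeasurableSpace.comap b ⊤ ≤ _) _ ⟨{q.2}, trivial, rfl⟩)
  · rintro _ ⟨s, -, rfl⟩
    exact ⟨Prod.fst ⁻¹' s, trivial, rfl⟩
  · rintro _ ⟨s, -, rfl⟩
    exact ⟨Prod.snd ⁻¹' s, trivial, rfl⟩

end EntropyCalculus

section Translates

variable {G X : Type*} [Group G]

instance finite_smul_set (s : G) (F : Set G) [Finite F] : Finite (s • F : Set G) :=
  (F.toFinite.smul_set (a := s)).to_subtype

namespace BorelAction

theorem partSA_union [MeasurableSpace X] (T : BorelAction G X) (F K : Set G) (a : X → ℕ) :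
    T.partSA (F ∪ K) a = T.partSA F a ⊔ T.partSA K a :=
  iSup_union

theorem partSA_mono [MeasurableSpace X] (T : BorelAction G X) {F K : Set G} (h : F ⊆ K)
    (a : X → ℕ) : T.partSA F a ≤ T.partSA K a :=
  biSup_mono h

theorem partSA_le [mX : MeasurableSpace X] (T : BorelAction G X) (F : Set G) {a : X → ℕ}
    (ha : Measurable a) : T.partSA F a ≤ mX :=
  iSup₂_le fun f _ => (ha.comp (T.measurable_act f⁻¹)).comap_le

theorem comap_joinF [mX : MeasurableSpace X] (T : BorelAction G X) (F : Set G) [Finite F]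
    (a : X → ℕ) : MeasurableSpace.comap (T.joinF F a) ⊤ = T.partSA F a := by
  refine le_antisymm (comap_top_le_of_fibers _ fun i => ?_)
    (iSup₂_le fun f hf => ?_)
  · have : T.joinF F a ⁻¹' {i} = ⋂ f : F, T.tr (f : G) a ⁻¹' {i f} := by
      ext x
      simp [joinF, tr, funext_iff]
    rw [this]
    exact MeasurableSet.iInter fun f =>
      (le_iSup₂ (f := fun (g : G) (_ : g ∈ F) => MeasurableSpace.comap (T.tr g a) ⊤)
        (f : G) f.2) _ ⟨{i f}, trivial, rfl⟩
  · rintro _ ⟨s, -, rfl⟩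
    exact ⟨{i | i ⟨f, hf⟩ ∈ s}, trivial, rfl⟩

theorem measurableSet_joinF_preimage [mX : MeasurableSpace X] (T : BorelAction G X) (F : Set G)
    [Finite F] {a : X → ℕ} (ha : Measurable a) (i : F → ℕ) :
    MeasurableSet (T.joinF F a ⁻¹' {i}) :=
  T.partSA_le F ha _ (T.comap_joinF F a ▸ ⟨{i}, trivial, rfl⟩)

theorem comap_act_partSA [mX : MeasurableSpace X] (T : BorelAction G X) (s : G) (F : Set G)
    (a : X → ℕ) : (T.partSA F a).comap (T.act s⁻¹) = T.partSA (s • F) a := by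
  simp only [partSA, MeasurableSpace.comap_iSup, MeasurableSpace.comap_comp, ← Set.image_smul,
    iSup_image, smul_eq_mul]
  refine iSup_congr fun f => iSup_congr fun _ => ?_
  congr 1
  funext x
  simp [tr, T.act_mul]

end BorelAction

theorem InvariantSA.comap_act {m : MeasurableSpace X} [mX : MeasurableSpace X]
    {T : BorelAction G X} (hm : InvariantSA m T) (g : G) : m.comap (T.act g) = m := by
  refine le_antisymm ?_ fun B hB => ?_
  · rintro _ ⟨B, hB, rfl⟩
    exact hm.2 g B hB
  · refine ⟨T.act g⁻¹ ⁻¹' B, hm.2 g⁻¹ B hB, ?_⟩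
    ext x
    simp [← T.act_mul, T.act_one]

/-- The conditional entropy `H(F · α / K · α ∨ m)`. -/
noncomputable def relEnt (m : MeasurableSpace X) [mX : MeasurableSpace X] (μ : Measure X)
    (T : BorelAction G X) (a : X → ℕ) (F : Set G) [Finite F] (K : Set G) : ℝ≥0∞ :=
  condEntS (m ⊔ T.partSA K a) μ (T.joinF F a)

variable {m : MeasurableSpace X} [mX : MeasurableSpace X] {μ : Measure X} [IsProbabilityMeasure μ]
  {T : BorelAction G X} {a : X → ℕ}

theorem relEnt_union (hm : m ≤ mX) (ha : Measurable a) (F F' K : Set G) [Finite F] [Finite F'] :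
    relEnt m μ T a (F ∪ F') K = relEnt m μ T a F' K + relEnt m μ T a F (K ∪ F') := by
  have hK : m ⊔ T.partSA K a ≤ mX := sup_le hm (T.partSA_le K ha)
  rw [relEnt, ← condEntS_eq_of_comap_eq _ hK μ (T.measurableSet_joinF_preimage (F ∪ F') ha)
      (a := fun x => (T.joinF F a x, T.joinF F' a x)),
    condEntS_prod _ hK μ (T.measurableSet_joinF_preimage F ha)
      (T.measurableSet_joinF_preimage F' ha), relEnt, relEnt, T.comap_joinF, T.partSA_union,
    sup_assoc]
  rw [comap_prodMk_top, T.comap_joinF, T.comap_joinF, T.comap_joinF, T.partSA_union]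

theorem relEnt_anti (hm : m ≤ mX) (ha : Measurable a) (F : Set G) [Finite F] {K K' : Set G}
    (h : K ⊆ K') : relEnt m μ T a F K' ≤ relEnt m μ T a F K :=
  condEntS_anti _ _ (sup_le_sup_left (T.partSA_mono h a) m) (sup_le hm (T.partSA_le K' ha)) μ
    (T.measurableSet_joinF_preimage F ha)

theorem relEnt_eq_zero (hm : m ≤ mX) (ha : Measurable a) {F : Set G} [Finite F] {K : Set G}
    (h : F ⊆ K) : relEnt m μ T a F K = 0 :=
  condEntS_eq_zero _ (sup_le hm (T.partSA_le K ha)) μ fun i =>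
    ((T.partSA_mono h a).trans le_sup_right) _ (T.comap_joinF F a ▸ ⟨{i}, trivial, rfl⟩)

theorem relEnt_mono (hm : m ≤ mX) (ha : Measurable a) {F F' : Set G} [Finite F] [Finite F']
    (h : F ⊆ F') (K : Set G) : relEnt m μ T a F K ≤ relEnt m μ T a F' K := by
  have hu := relEnt_union (μ := μ) (T := T) hm ha F' F K
  simp only [Set.union_eq_self_of_subset_right h] at hu
  exact hu ▸ le_self_add

theorem relEnt_biUnion_le (hm : m ≤ mX) (ha : Measurable a) {ι : Type*} (P : Finset ι)
    (F : ι → Set G) [∀ i, Finite (F i)] (K : Set G) :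
    relEnt m μ T a (⋃ i ∈ P, F i) K ≤ ∑ i ∈ P, relEnt m μ T a (F i) K := by
  classical
  induction P using Finset.induction_on with
  | empty => exact (relEnt_eq_zero hm ha (by simp)).le
  | insert i P hi ih =>
    rw [Finset.sum_insert hi]
    simp only [Finset.set_biUnion_insert]
    rw [relEnt_union hm ha, add_comm]
    exact add_le_add (relEnt_anti hm ha _ Set.subset_union_left) ih

/-- The partition `s · F · α`, indexed by `F`, has the entropy of the join over `s • F`. -/
theorem condEntS_translate (hm : m ≤ mX) (ha : Measurable a) (s : G) (F K : Set G) [Finite F] :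
    condEntS (m ⊔ T.partSA K a) μ (fun x (g : F) => a (T.act (s * (g : G))⁻¹ x))
      = relEnt m μ T a (s • F) K := by
  refine condEntS_eq_of_comap_eq _ (sup_le hm (T.partSA_le K ha)) μ
    (T.measurableSet_joinF_preimage (s • F) ha) ?_
  rw [T.comap_joinF, ← T.comap_act_partSA, ← T.comap_joinF, MeasurableSpace.comap_comp]
  congr 1
  funext x g
  simp [BorelAction.joinF, T.act_mul]

theorem relEnt_smul (hT : T.Preserves μ) (hm : InvariantSA m T) (ha : Measurable a) (s : G)
    (F K : Set G) [Finite F] :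
    relEnt m μ T a (s • F) (s • K) = relEnt m μ T a F K := by
  rw [← condEntS_translate hm.1 ha, relEnt, ← condEntS_comap _ (sup_le hm.1 (T.partSA_le K ha)) μ
    (T.measurableSet_joinF_preimage F ha) (hT s⁻¹), MeasurableSpace.comap_sup, hm.comap_act,
    T.comap_act_partSA]
  congr 1
  funext x g
  simp [BorelAction.joinF, T.act_mul]

end Translates

section Balls

variable {r : ℕ}

theorem letter_eq_mk (p : Fin r × Bool) : letter p = FreeGroup.mk [p] := by
  rcases p with ⟨i, _ | _⟩ <;> simp [letter, FreeGroup.of, FreeGroup.inv_mk, FreeGroup.invRev]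

theorem letter_not (p : Fin r × Bool) : letter (p.1, !p.2) = (letter p)⁻¹ := by
  rcases p with ⟨i, _ | _⟩ <;> simp [letter]

theorem letter_smul_ball_subset (p : Fin r × Bool) (n : ℕ) :
    letter p • ball r n ⊆ ball r (n + 1) := by
  rintro _ ⟨g, hg, rfl⟩
  have h1 : FreeGroup.norm (letter p) ≤ 1 := letter_eq_mk p ▸ FreeGroup.norm_mk_le
  have h2 : FreeGroup.norm g ≤ n := hg
  have h3 := FreeGroup.norm_mul_le (letter p) g
  change FreeGroup.norm (letter p * g) ≤ n + 1
  omega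

theorem ball_subset_ball_succ (n : ℕ) : ball r n ⊆ ball r (n + 1) :=
  fun _ hg => Nat.le_succ_of_le hg

theorem ball_succ_subset (n : ℕ) :
    ball r (n + 1) ⊆ (⋃ p ∈ (Finset.univ : Finset (Fin r × Bool)), letter p • ball r n)
      ∪ ball r n := by
  intro g hg
  have hg' : g.toWord.length ≤ n + 1 := hg
  rcases hw : g.toWord with _ | ⟨p, l⟩
  · refine Or.inr ?_
    change g.toWord.length ≤ n
    simp [hw]
  · refine Or.inl (Set.mem_biUnion (Finset.mem_univ p) ⟨FreeGroup.mk l, ?_, ?_⟩)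
    · rw [hw, List.length_cons] at hg'
      have : FreeGroup.norm (FreeGroup.mk l) ≤ l.length := FreeGroup.norm_mk_le
      exact this.trans (by omega)
    · change letter p * FreeGroup.mk l = g
      rw [letter_eq_mk, FreeGroup.mul_mk, List.singleton_append, ← hw, FreeGroup.mk_toWord]

end Balls

/-- The two entropy inequalities of Lemma `LEM SPINEQ`. -/
theorem statement7 {r : ℕ} (hr : 1 ≤ r) {X : Type*}
    (m : MeasurableSpace X) [mX : MeasurableSpace X] [StandardBorelSpace X]
    (μ : Measure X) [IsProbabilityMeasure μ]
    (T : BorelAction (FG r) X) (hT : T.Preserves μ)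
    (hm : InvariantSA m T)
    (a : X → ℕ) (ha : Measurable a) (n : ℕ) :
    condEntS (m ⊔ T.partSA (ball r n) a) μ (T.joinF (ball r (n + 1)) a)
      ≤ (∑ p : Fin r × Bool,
          condEntS (m ⊔ T.partSA (ball r n) a) μ
            (fun x (g : ball r n) => a (T.act (letter p * (g : FG r))⁻¹ x)))
    ∧ (∑ p : Fin r × Bool,
        condEntS (m ⊔ T.partSA (ball r (n + 1)) a) μ
          (fun x (g : ball r (n + 1)) => a (T.act (letter p * (g : FG r))⁻¹ x)))
      ≤ ((2 * r - 1 : ℕ) : ℝ≥0∞)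
          * condEntS (m ⊔ T.partSA (ball r n) a) μ (T.joinF (ball r (n + 1)) a) := by
  have hfirst : relEnt m μ T a (ball r (n + 1)) (ball r n)
      ≤ ∑ p : Fin r × Bool, relEnt m μ T a (letter p • ball r n) (ball r n) := by
    refine (relEnt_mono hm.1 ha (ball_succ_subset n) _).trans ?_
    rw [relEnt_union hm.1 ha, relEnt_eq_zero hm.1 ha subset_rfl, zero_add, Set.union_self]
    exact relEnt_biUnion_le hm.1 ha _ _ _
  simp only [condEntS_translate hm.1 ha]
  refine ⟨hfirst, ?_⟩
  change _ ≤ ((2 * r - 1 : ℕ) : ℝ≥0∞) * relEnt m μ T a (ball r (n + 1)) (ball r n)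
  set h := relEnt m μ T a (ball r (n + 1)) (ball r n) with hdef
  rcases eq_or_ne h ⊤ with htop | hfin
  · rw [htop, ENNReal.mul_top (by exact_mod_cast (by omega : 2 * r - 1 ≠ 0))]
    exact le_top
  have hterm : ∀ p : Fin r × Bool,
      relEnt m μ T a (letter p • ball r (n + 1)) (ball r (n + 1))
        + relEnt m μ T a (letter (p.1, !p.2) • ball r n) (ball r n) ≤ h := by
    intro p
    have hchain := relEnt_union (μ := μ) (T := T) hm.1 ha (ball r (n + 1))
      (letter (p.1, !p.2) • ball r n) (ball r n)
    simp only [Set.union_eq_self_of_subset_right (letter_smul_ball_subset (p.1, !p.2) n)]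
      at hchain
    rw [hdef, hchain, add_comm]
    gcongr
    rw [← relEnt_smul hT hm ha (letter p) (ball r (n + 1))]
    refine relEnt_anti hm.1 ha _ ?_
    rw [Set.smul_set_union, letter_not, smul_inv_smul]
    exact Set.union_subset (letter_smul_ball_subset p n) (ball_subset_ball_succ n)
  have hflip : ∑ p : Fin r × Bool, relEnt m μ T a (letter (p.1, !p.2) • ball r n) (ball r n)
      = ∑ p : Fin r × Bool, relEnt m μ T a (letter p • ball r n) (ball r n) :=
    ((Equiv.refl (Fin r)).prodCongr Equiv.boolNot).sum_comp
      fun p => relEnt m μ T a (letter p • ball r n) (ball r n)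
  refine ENNReal.le_of_add_le_add_right hfin ?_
  calc _ ≤ ∑ p : Fin r × Bool, relEnt m μ T a (letter p • ball r (n + 1)) (ball r (n + 1))
        + ∑ p : Fin r × Bool, relEnt m μ T a (letter (p.1, !p.2) • ball r n) (ball r n) := by
        rw [hflip]
        gcongr
    _ ≤ ∑ _p : Fin r × Bool, h := by
        rw [← Finset.sum_add_distrib]
        exact Finset.sum_le_sum fun p _ => hterm p
    _ = ((2 * r - 1 : ℕ) : ℝ≥0∞) * h + h := by
        have hcard : r * 2 = (2 * r - 1) + 1 := by omega
        rw [Finset.sum_const, Finset.card_univ, Fintype.card_prod, Fintype.card_fin,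
          Fintype.card_bool, hcard, nsmul_eq_mul, Nat.cast_add, Nat.cast_one, add_mul, one_mul]

end FPaper
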